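/- arXiv:1701.07956 — 2 statements merged into one kernel-verified Lean document; each statement's English description precedes it below -/
import Mathlib

section
/- Let (u_i)_{i∈[n]} be an n-player m-action game with payoffs in [0,1], let x = (x_i) be an exact Nash equilibrium, let ε > 0, and let s = (s_i) be a profile of mixed strategies such that (a) the support of s_i is contained in the support of x_i for every i, and (b) for a given player i, |u_i(a_i, s_{−i}) − u_i(a_i, x_{−i})| ≤ ε/2 for every action a_i ∈ [m]. Then player i is ε-best replying at s: u_i(s_i, s_{−i}) ≥ u_i(a_i, s_{−i}) − ε for every a_i ∈ [m]. -/
open Finset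

/-- Expected payoff of payoff function `u` under the mixed strategy profile `x`,
where `x i b` is the probability that player `i` plays action `b`. -/
noncomputable def expPay {n m : ℕ} (u : (Fin n → Fin m) → ℝ) (x : Fin n → Fin m → ℝ) : ℝ :=
  ∑ a : Fin n → Fin m, (∏ i, x i (a i)) * u a

/-- The pure strategy playing action `b` with probability one. -/
def pureStrat {m : ℕ} (b : Fin m) : Fin m → ℝ := fun b' => if b' = b then 1 else 0

/-- `p` is a mixed strategy, i.e. a probability distribution on `Fin m`. -/
def IsMixed {m : ℕ} (p : Fin m → ℝ) : Prop := (∀ b, 0 ≤ p b) ∧ ∑ b, p b = 1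

/-- Expected payoff is linear in the strategy of player `i`. -/
lemma expPay_decomp {n m : ℕ} (u : (Fin n → Fin m) → ℝ) (x : Fin n → Fin m → ℝ) (i : Fin n) :
    expPay u x = ∑ b, x i b * expPay u (Function.update x i (pureStrat b)) := by
  unfold expPay
  simp_rw [Finset.mul_sum]
  rw [Finset.sum_comm]
  refine Finset.sum_congr rfl fun a _ => ?_
  have key : ∀ b, ∏ j, (Function.update x i (pureStrat b)) j (a j)
      = (if a i = b then 1 else 0) * ∏ j ∈ Finset.univ.erase i, x j (a j) := by
    intro b
    rw [← Finset.mul_prod_erase _ _ (Finset.mem_univ i)]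
    congr 1
    · simp [pureStrat]
    · refine Finset.prod_congr rfl fun j hj => ?_
      rw [Function.update_of_ne (Finset.ne_of_mem_erase hj)]
  simp_rw [key]
  rw [← Finset.mul_prod_erase _ _ (Finset.mem_univ i)]
  rw [Finset.sum_eq_single (a i)]
  · simp [mul_assoc]
  · intro b _ hb
    simp [Ne.symm hb]
  · simp

/-- If `x` is an exact Nash equilibrium, `s` is a profile of mixed strategies whose supports
are contained in the corresponding supports of `x`, and for player `i` every pure action yields
against `s₋ᵢ` a payoff within `ε/2` of its payoff against `x₋ᵢ`, then player `i` is
`ε`-best replying at `s`. -/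
theorem stmt2 (n m : ℕ) (u : Fin n → (Fin n → Fin m) → ℝ)
    (hu : ∀ i a, u i a ∈ Set.Icc (0:ℝ) 1)
    (x : Fin n → Fin m → ℝ) (hx : ∀ i, IsMixed (x i))
    (hNash : ∀ i (b : Fin m), expPay (u i) (Function.update x i (pureStrat b)) ≤ expPay (u i) x)
    (ε : ℝ) (hε : 0 < ε)
    (s : Fin n → Fin m → ℝ) (hs : ∀ i, IsMixed (s i))
    (hsupp : ∀ j b, s j b ≠ 0 → x j b ≠ 0)
    (i : Fin n)
    (hclose : ∀ b : Fin m, |expPay (u i) (Function.update s i (pureStrat b)) -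
        expPay (u i) (Function.update x i (pureStrat b))| ≤ ε / 2) :
    ∀ b : Fin m, expPay (u i) (Function.update s i (pureStrat b)) - ε ≤ expPay (u i) s := by
  intro b
  -- every action in the support of `x i` attains the equilibrium payoff
  have hsup : ∀ c, x i c ≠ 0 →
      expPay (u i) (Function.update x i (pureStrat c)) = expPay (u i) x := by
    have h0 : ∑ c, x i c * (expPay (u i) x - expPay (u i) (Function.update x i (pureStrat c)))
        = 0 := by
      simp_rw [mul_sub]
      rw [Finset.sum_sub_distrib, ← expPay_decomp, ← Finset.sum_mul, (hx i).2]
      ring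
    rw [Finset.sum_eq_zero_iff_of_nonneg
      (fun c _ => mul_nonneg ((hx i).1 c) (sub_nonneg.2 (hNash i c)))] at h0
    intro c hc
    have h1 := (mul_eq_zero.1 (h0 c (Finset.mem_univ c))).resolve_left hc
    linarith
  have hlow : ∑ c, s i c * (expPay (u i) x - ε / 2) ≤ expPay (u i) s := by
    rw [expPay_decomp (u i) s i]
    refine Finset.sum_le_sum fun c _ => ?_
    by_cases hc : s i c = 0
    · simp [hc]
    · refine mul_le_mul_of_nonneg_left ?_ ((hs i).1 c)
      have h1 := hsup c (hsupp i c hc)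
      have h2 := (abs_le.1 (hclose c)).1
      linarith
  rw [← Finset.sum_mul, (hs i).2] at hlow
  have h3 := (abs_le.1 (hclose b)).2
  have h4 := hNash i b
  linarith
end

section
/- Fix α ≥ 1. Suppose there exists a constant k ∈ ℕ such that for every α-balanced matrix M ∈ {0,1}^{n×m}, the majority matching-pennies game defined by M has a 0.4-Nash equilibrium in mixed strategies in which every one of the n+m players plays his action 1 with probability either (k+1)/(2k) or (k−1)/(2k). Then there exists a constant C > 0 such that every α-balanced matrix M ∈ {0,1}^{n×m} satisfies disc(M) ≤ C·√t, where t is the sum of the first row of M. -/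
open Finset

/-- The pure action encoded by a Boolean: `true ↦ 1`, `false ↦ -1`. -/
def pm (b : Bool) : ℝ := if b then 1 else -1

/-- Probability of the pure Boolean profile `b` when each coordinate `i` independently
plays `true` (i.e. action `1`) with probability `ρ i`. -/
noncomputable def prProf {n : ℕ} (ρ : Fin n → ℝ) (b : Fin n → Bool) : ℝ :=
  ∏ i, if b i then ρ i else 1 - ρ i

/-- Expected payoff of row player `i` in the majority matching-pennies game defined by `M`,
under the mixed profile `(ρ, σ)`: he receives the sign of the sum of his row. -/
noncomputable def expRow {n m : ℕ} (M : Fin n → Fin m → ℝ) (i : Fin n)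
    (ρ : Fin n → ℝ) (σ : Fin m → ℝ) : ℝ :=
  ∑ b : Fin n → Bool, ∑ c : Fin m → Bool,
    prProf ρ b * prProf σ c * Real.sign (pm (b i) * ∑ j, M i j * pm (c j))

/-- Expected payoff of column player `j` in the majority matching-pennies game defined by `M`,
under the mixed profile `(ρ, σ)`: he receives minus the sign of the sum of his column. -/
noncomputable def expCol {n m : ℕ} (M : Fin n → Fin m → ℝ) (j : Fin m)
    (ρ : Fin n → ℝ) (σ : Fin m → ℝ) : ℝ :=
  ∑ b : Fin n → Bool, ∑ c : Fin m → Bool,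
    prProf ρ b * prProf σ c * (- Real.sign (pm (c j) * ∑ i, M i j * pm (b i)))

/-- The matrix `M` has entries in `{0,1}`. -/
def Entries01 {n m : ℕ} (M : Fin n → Fin m → ℝ) : Prop := ∀ i j, M i j = 0 ∨ M i j = 1

/-- `M` is `α`-balanced: every ratio of two of the row sums and column sums lies in `[1/α, α]`. -/
def BalancedMat {n m : ℕ} (α : ℝ) (M : Fin n → Fin m → ℝ) : Prop :=
  (∀ i i', (∑ j, M i j) ≤ α * ∑ j, M i' j) ∧
  (∀ j j', (∑ i, M i j) ≤ α * ∑ i, M i j') ∧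
  (∀ i j, (∑ j', M i j') ≤ α * ∑ i', M i' j) ∧
  (∀ i j, (∑ i', M i' j) ≤ α * ∑ j', M i j')

/-- `(ρ, σ)` is an `ε`-Nash equilibrium of the majority matching-pennies game defined by `M`:
it is a profile of mixed strategies, and no player can gain more than `ε` by a unilateral
deviation to any mixed strategy. -/
def IsENashMMP {n m : ℕ} (M : Fin n → Fin m → ℝ) (ε : ℝ)
    (ρ : Fin n → ℝ) (σ : Fin m → ℝ) : Prop :=
  (∀ i, ρ i ∈ Set.Icc (0:ℝ) 1) ∧ (∀ j, σ j ∈ Set.Icc (0:ℝ) 1) ∧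
  (∀ i, ∀ q ∈ Set.Icc (0:ℝ) 1, expRow M i (Function.update ρ i q) σ ≤ expRow M i ρ σ + ε) ∧
  (∀ j, ∀ q ∈ Set.Icc (0:ℝ) 1, expCol M j ρ (Function.update σ j q) ≤ expCol M j ρ σ + ε)

lemma sum_prProf_prod {n : ℕ} (ρ : Fin n → ℝ) (g : Fin n → Bool → ℝ) :
    ∑ b : Fin n → Bool, prProf ρ b * ∏ i, g i (b i)
      = ∏ i, (ρ i * g i true + (1 - ρ i) * g i false) := by
  have h := Finset.prod_univ_sum (fun _ : Fin n => (Finset.univ : Finset Bool))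
    (fun i x => (if x then ρ i else 1 - ρ i) * g i x)
  rw [Fintype.piFinset_univ] at h
  simp only [Fintype.sum_bool, if_true, Bool.false_eq_true, if_false] at h
  rw [h]
  refine Finset.sum_congr rfl fun b _ => ?_
  rw [prProf, ← Finset.prod_mul_distrib]

lemma sum_prProf {n : ℕ} (ρ : Fin n → ℝ) : ∑ b : Fin n → Bool, prProf ρ b = 1 := by
  have h := sum_prProf_prod ρ (fun _ _ => 1)
  simpa using h

lemma sum_prProf_one {n : ℕ} (ρ : Fin n → ℝ) (j : Fin n) (h : Bool → ℝ) :
    ∑ b : Fin n → Bool, prProf ρ b * h (b j) = ρ j * h true + (1 - ρ j) * h false := by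
  have e := sum_prProf_prod ρ (fun i x => if i = j then h x else 1)
  simp only [Finset.prod_ite_eq', Finset.mem_univ, if_true] at e
  rw [e, Finset.prod_eq_single j]
  · simp
  · intro i _ hi
    simp [hi]
  · simp

lemma sum_prProf_two {n : ℕ} (ρ : Fin n → ℝ) (j l : Fin n) (hjl : j ≠ l) (f h : Bool → ℝ)
    (h0 : ρ j * f true + (1 - ρ j) * f false = 0) :
    ∑ b : Fin n → Bool, prProf ρ b * (f (b j) * h (b l)) = 0 := by
  have e := sum_prProf_prod ρ
    (fun i x => (if i = j then f x else 1) * (if i = l then h x else 1))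
  simp only [Finset.prod_mul_distrib, Finset.prod_ite_eq', Finset.mem_univ, if_true] at e
  rw [e]
  apply Finset.prod_eq_zero (Finset.mem_univ j)
  simp [hjl, h0]

lemma sign_pm_mul (b : Bool) (x : ℝ) : Real.sign (pm b * x) = pm b * Real.sign x := by
  cases b <;> simp [pm, Real.sign_neg]

lemma prProf_nonneg {n : ℕ} (ρ : Fin n → ℝ) (h : ∀ i, ρ i ∈ Set.Icc (0:ℝ) 1)
    (b : Fin n → Bool) : 0 ≤ prProf ρ b := by
  refine Finset.prod_nonneg fun i _ => ?_
  have := h i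
  split_ifs
  · exact this.1
  · linarith [this.2]

noncomputable def eSign {m : ℕ} (a : Fin m → ℝ) (σ : Fin m → ℝ) : ℝ :=
  ∑ c : Fin m → Bool, prProf σ c * Real.sign (∑ j, a j * pm (c j))

lemma expRow_eq {n m : ℕ} (M : Fin n → Fin m → ℝ) (i : Fin n)
    (ρ : Fin n → ℝ) (σ : Fin m → ℝ) :
    expRow M i ρ σ = (2 * ρ i - 1) * eSign (M i) σ := by
  have h1 := sum_prProf_one ρ i pm
  have h2 : 2 * ρ i - 1 = ∑ b : Fin n → Bool, prProf ρ b * pm (b i) := by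
    rw [h1]; simp [pm]; ring
  rw [h2, expRow, eSign, Finset.sum_mul_sum]
  refine Finset.sum_congr rfl fun b _ => Finset.sum_congr rfl fun c _ => ?_
  rw [sign_pm_mul]; ring

lemma expCol_eq {n m : ℕ} (M : Fin n → Fin m → ℝ) (j : Fin m)
    (ρ : Fin n → ℝ) (σ : Fin m → ℝ) :
    expCol M j ρ σ = -((2 * σ j - 1) * eSign (fun i => M i j) ρ) := by
  have h1 := sum_prProf_one σ j pm
  have h2 : 2 * σ j - 1 = ∑ b : Fin m → Bool, prProf σ b * pm (b j) := by
    rw [h1]; simp [pm]; ring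
  rw [h2, expCol, eSign, mul_comm (∑ b : Fin m → Bool, _), Finset.sum_mul_sum,
    ← Finset.sum_neg_distrib]
  refine Finset.sum_congr rfl fun b _ => ?_
  rw [← Finset.sum_neg_distrib]
  refine Finset.sum_congr rfl fun c _ => ?_
  rw [sign_pm_mul]; ring

lemma variance_le {m : ℕ} (a : Fin m → ℝ) (ha : ∀ j, a j = 0 ∨ a j = 1) (σ : Fin m → ℝ) :
    ∑ c : Fin m → Bool, prProf σ c *
      ((∑ j, a j * pm (c j)) - ∑ j, a j * (2 * σ j - 1)) ^ 2 ≤ ∑ j, a j := by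
  have key : ∀ c : Fin m → Bool, prProf σ c *
      ((∑ j, a j * pm (c j)) - ∑ j, a j * (2 * σ j - 1)) ^ 2
      = ∑ j, ∑ l, a j * a l * (prProf σ c *
        ((pm (c j) - (2 * σ j - 1)) * (pm (c l) - (2 * σ l - 1)))) := by
    intro c
    rw [← Finset.sum_sub_distrib, sq, Finset.sum_mul_sum, Finset.mul_sum]
    refine Finset.sum_congr rfl fun j _ => ?_
    rw [Finset.mul_sum]
    refine Finset.sum_congr rfl fun l _ => ?_
    ring
  simp only [key]
  rw [Finset.sum_comm]
  refine Finset.sum_le_sum fun j _ => ?_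
  rw [Finset.sum_comm, Finset.sum_eq_single j]
  · rw [← Finset.mul_sum]
    have := sum_prProf_one σ j
      (fun x => (pm x - (2 * σ j - 1)) * (pm x - (2 * σ j - 1)))
    rw [this]
    rcases ha j with h | h <;> rw [h]
    · simp
    · simp only [pm, if_true, Bool.false_eq_true, if_false]
      nlinarith [sq_nonneg (2 * σ j - 1)]
  · intro l _ hl
    rw [← Finset.mul_sum]
    have := sum_prProf_two σ j l hl.symm (fun x => pm x - (2 * σ j - 1))
      (fun x => pm x - (2 * σ l - 1)) (by simp [pm]; ring)
    rw [this, mul_zero]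
  · simp

lemma sign_lower (S μ : ℝ) (hμ : 0 < μ) : 1 - 2 / μ ^ 2 * (S - μ) ^ 2 ≤ Real.sign S := by
  rcases lt_or_ge 0 S with h | h
  · rw [Real.sign_of_pos h]
    have : 0 ≤ 2 / μ ^ 2 * (S - μ) ^ 2 := by positivity
    linarith
  · have h1 : μ ^ 2 ≤ (S - μ) ^ 2 := by nlinarith
    have h2 : 2 ≤ 2 / μ ^ 2 * (S - μ) ^ 2 := by
      rw [div_mul_eq_mul_div, le_div_iff₀ (by positivity)]; linarith
    rcases Real.sign_apply_eq S with h | h | h <;> rw [h] <;> linarith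

lemma eSign_lower {m : ℕ} (a : Fin m → ℝ) (ha : ∀ j, a j = 0 ∨ a j = 1) (σ : Fin m → ℝ)
    (hσ : ∀ i, σ i ∈ Set.Icc (0:ℝ) 1) (hμ : 0 < ∑ j, a j * (2 * σ j - 1))
    (hb : 100 * ∑ j, a j ≤ (∑ j, a j * (2 * σ j - 1)) ^ 2) : 0.98 ≤ eSign a σ := by
  set μ := ∑ j, a j * (2 * σ j - 1) with hμd
  have h1 : ∑ c : Fin m → Bool, prProf σ c *
      (1 - 2 / μ ^ 2 * ((∑ j, a j * pm (c j)) - μ) ^ 2) ≤ eSign a σ :=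
    Finset.sum_le_sum fun c _ =>
      mul_le_mul_of_nonneg_left (sign_lower _ _ hμ) (prProf_nonneg σ hσ c)
  have h2 : ∑ c : Fin m → Bool, prProf σ c *
      (1 - 2 / μ ^ 2 * ((∑ j, a j * pm (c j)) - μ) ^ 2)
      = 1 - 2 / μ ^ 2 * ∑ c : Fin m → Bool, prProf σ c * ((∑ j, a j * pm (c j)) - μ) ^ 2 := by
    conv_rhs => rw [← sum_prProf σ, Finset.mul_sum, ← Finset.sum_sub_distrib]
    refine Finset.sum_congr rfl fun c _ => ?_
    ring
  have h3 := variance_le a ha σ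
  rw [← hμd] at h3
  have h4 : 2 / μ ^ 2 * ∑ c : Fin m → Bool, prProf σ c * ((∑ j, a j * pm (c j)) - μ) ^ 2
      ≤ 0.02 := by
    rw [div_mul_eq_mul_div, div_le_iff₀ (by positivity)]
    linarith
  rw [h2] at h1
  linarith

lemma sign_upper (S μ : ℝ) (hμ : μ < 0) : Real.sign S ≤ -(1 - 2 / μ ^ 2 * (S - μ) ^ 2) := by
  have h := sign_lower (-S) (-μ) (by linarith)
  rw [Real.sign_neg] at h
  have e : (-S - -μ) ^ 2 = (S - μ) ^ 2 := by ring
  rw [e, neg_sq] at h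
  linarith

lemma eSign_upper {m : ℕ} (a : Fin m → ℝ) (ha : ∀ j, a j = 0 ∨ a j = 1) (σ : Fin m → ℝ)
    (hσ : ∀ i, σ i ∈ Set.Icc (0:ℝ) 1) (hμ : ∑ j, a j * (2 * σ j - 1) < 0)
    (hb : 100 * ∑ j, a j ≤ (∑ j, a j * (2 * σ j - 1)) ^ 2) : eSign a σ ≤ -0.98 := by
  set μ := ∑ j, a j * (2 * σ j - 1) with hμd
  have h1 : eSign a σ ≤ ∑ c : Fin m → Bool, prProf σ c *
      (-(1 - 2 / μ ^ 2 * ((∑ j, a j * pm (c j)) - μ) ^ 2)) :=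
    Finset.sum_le_sum fun c _ =>
      mul_le_mul_of_nonneg_left (sign_upper _ _ hμ) (prProf_nonneg σ hσ c)
  have h2 : ∑ c : Fin m → Bool, prProf σ c *
      (-(1 - 2 / μ ^ 2 * ((∑ j, a j * pm (c j)) - μ) ^ 2))
      = 2 / μ ^ 2 * (∑ c : Fin m → Bool, prProf σ c * ((∑ j, a j * pm (c j)) - μ) ^ 2) - 1 := by
    conv_rhs => rw [← sum_prProf σ, Finset.mul_sum, ← Finset.sum_sub_distrib]
    refine Finset.sum_congr rfl fun c _ => ?_
    ring
  have h3 := variance_le a ha σ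
  rw [← hμd] at h3
  have h4 : 2 / μ ^ 2 * ∑ c : Fin m → Bool, prProf σ c * ((∑ j, a j * pm (c j)) - μ) ^ 2
      ≤ 0.02 := by
    have : 0 < μ ^ 2 := by nlinarith
    rw [div_mul_eq_mul_div, div_le_iff₀ this]
    linarith
  rw [h2] at h1
  linarith

lemma eSign_one (σ : Fin 1 → ℝ) : eSign (fun _ => 1) σ = 2 * σ 0 - 1 := by
  have h := sum_prProf_one σ 0 (fun x => Real.sign (pm x))
  simp only [eSign, Finset.univ_unique, Finset.sum_singleton, one_mul] at h ⊢
  refine Eq.trans h ?_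
  simp [pm, Real.sign_neg]
  ring

/-- Conversely, if there is a constant `k` such that every majority matching-pennies game
defined by an `α`-balanced 0-1 matrix has a `0.4`-Nash equilibrium in which every player
plays action `1` with probability `(k+1)/(2k)` or `(k−1)/(2k)`, then the `α`-balanced
Beck–Fiala conjecture holds: there is a constant `C > 0` such that every `α`-balanced 0-1
matrix `M` satisfies `disc(M) ≤ C√t`, where `t` is the sum of the first row. -/
theorem stmt5 (α : ℝ) (hα : 1 ≤ α)
    (hEq : ∃ k : ℕ, 0 < k ∧ ∀ (n m : ℕ) (M : Fin (n + 1) → Fin (m + 1) → ℝ),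
      Entries01 M → BalancedMat α M →
      ∃ (ρ : Fin (n + 1) → ℝ) (σ : Fin (m + 1) → ℝ),
        (∀ i, ρ i = ((k : ℝ) + 1) / (2 * k) ∨ ρ i = ((k : ℝ) - 1) / (2 * k)) ∧
        (∀ j, σ j = ((k : ℝ) + 1) / (2 * k) ∨ σ j = ((k : ℝ) - 1) / (2 * k)) ∧
        IsENashMMP M 0.4 ρ σ) :
    ∃ C : ℝ, 0 < C ∧ ∀ (n m : ℕ) (M : Fin (n + 1) → Fin (m + 1) → ℝ),
      Entries01 M → BalancedMat α M →
      ∃ χ : Fin (m + 1) → ℝ, (∀ j, χ j = 1 ∨ χ j = -1) ∧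
        ∀ i, |∑ j, M i j * χ j| ≤ C * Real.sqrt (∑ j, M 0 j) := by
  obtain ⟨k, hk0, hEq⟩ := hEq
  have hk2 : 2 ≤ k := by
    by_contra hlt
    have hk1 : k = 1 := by omega
    subst hk1
    obtain ⟨ρ, σ, hρ, hσ, -, -, hr, hc⟩ := hEq 0 0 (fun _ _ => 1) (fun _ _ => Or.inr rfl)
      (by simp [BalancedMat, hα])
    have hr1 := hr 0 1 (by simp)
    have hr0 := hr 0 0 (by simp)
    have hc1 := hc 0 1 (by simp)
    have hc0 := hc 0 0 (by simp)
    simp only [expRow_eq, expCol_eq, Function.update_self] at hr1 hr0 hc1 hc0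
    have e1 := eSign_one σ
    have e2 := eSign_one ρ
    simp only [Nat.reduceAdd] at *
    rw [e1] at hr1 hr0
    rw [e2] at hc1 hc0
    rcases hρ 0 with h | h <;> rcases hσ 0 with h' | h' <;> rw [h, h'] at hr1 hr0 hc1 hc0 <;>
      first | (norm_num at hr1; done) | (norm_num at hr0; done) | (norm_num at hc1; done) |
        (norm_num at hc0; done)
  have hkR : (2:ℝ) ≤ k := by exact_mod_cast hk2
  have hkpos : (0:ℝ) < k := by linarith
  refine ⟨10 * k * Real.sqrt α, by positivity, ?_⟩
  intro n m M hM hB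
  obtain ⟨ρ, σ, hρ, hσ, -, hσI, hr, -⟩ := hEq n m M hM hB
  have hσ' : ∀ j, (k:ℝ) * (2 * σ j - 1) = 1 ∨ (k:ℝ) * (2 * σ j - 1) = -1 := by
    intro j
    rcases hσ j with h | h <;> rw [h]
    · left; field_simp; ring
    · right; field_simp; ring
  refine ⟨fun j => k * (2 * σ j - 1), hσ', ?_⟩
  intro i
  have hsum : ∑ j, M i j * ((k:ℝ) * (2 * σ j - 1)) = k * ∑ j, M i j * (2 * σ j - 1) := by
    rw [Finset.mul_sum]
    exact Finset.sum_congr rfl fun j _ => by ring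
  rw [hsum]
  by_contra hcon
  push Not at hcon
  set μ := ∑ j, M i j * (2 * σ j - 1) with hμ
  have hα0 : 0 ≤ α := by linarith
  rw [abs_mul, abs_of_pos hkpos, mul_assoc, ← Real.sqrt_mul hα0] at hcon
  have hcon' : 10 * Real.sqrt (α * ∑ j, M 0 j) < |μ| := by
    have : (k:ℝ) * (10 * Real.sqrt (α * ∑ j, M 0 j)) < k * |μ| := by linarith
    exact lt_of_mul_lt_mul_left this hkpos.le
  have ht : 0 ≤ ∑ j, M 0 j := Finset.sum_nonneg fun j _ => by
    rcases hM 0 j with h | h <;> rw [h] <;> norm_num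
  have hsq := Real.sq_sqrt (mul_nonneg hα0 ht)
  have hs0 := Real.sqrt_nonneg (α * ∑ j, M 0 j)
  have hb : 100 * ∑ j, M i j ≤ μ ^ 2 := by
    have h1 := hB.1 i 0
    rw [← sq_abs μ]
    nlinarith
  have hne : μ ≠ 0 := by
    intro h0
    rw [h0, abs_zero] at hcon'
    linarith
  have hρ' : |2 * ρ i - 1| ≤ 1 / 2 := by
    have hh : (1:ℝ) / k ≤ 1 / 2 := one_div_le_one_div_of_le (by norm_num) hkR
    have hp : (0:ℝ) < 1 / k := by positivity
    rcases hρ i with h | h <;> rw [h]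
    · have : 2 * (((k:ℝ) + 1) / (2 * k)) - 1 = 1 / k := by field_simp; ring
      rw [this, abs_of_pos hp]; exact hh
    · have : 2 * (((k:ℝ) - 1) / (2 * k)) - 1 = -(1 / k) := by field_simp; ring
      rw [this, abs_neg, abs_of_pos hp]; exact hh
  obtain ⟨ha, hb'⟩ := abs_le.mp hρ'
  rcases lt_or_gt_of_ne hne with hneg | hpos
  · have he := eSign_upper (M i) (hM i) σ hσI hneg hb
    have h := hr i 0 (by simp)
    simp only [expRow_eq, Function.update_self] at h
    norm_num at he h
    nlinarith
  · have he := eSign_lower (M i) (hM i) σ hσI hpos hb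
    have h := hr i 1 (by simp)
    simp only [expRow_eq, Function.update_self] at h
    norm_num at he h
    nlinarith
end
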